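/- arXiv:2405.12953 — 5 statements merged into one kernel-verified Lean document; each statement's English description precedes it below -/
import Mathlib

section
/- Let R_0, R_1, ..., R_n be real-valued random variables on a probability space that are exchangeable and almost surely pairwise distinct, and let α ∈ (0,1). Then P(#{i ∈ {1,...,n} : R_i ≤ R_0} < (n+1)α/2) < α/2 + 1/(n+1), and P(#{i ∈ {1,...,n} : R_i ≤ R_0} ≤ (n+1)(1−α/2)) > 1 − α/2. -/
open MeasureTheory ProbabilityTheory Finset
open scoped ENNReal

/-- The number of coordinates of `v` strictly below the coordinate `v j`. -/
noncomputable def strictRank {ι : Type*} [Fintype ι] (v : ι → ℝ) (j : ι) : ℕ :=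
  (Finset.univ.filter (fun i => v i < v j)).card

section strictRank

variable {ι : Type*} [Fintype ι]

lemma strictRank_lt_card (v : ι → ℝ) (j : ι) : strictRank v j < Fintype.card ι := by
  refine Finset.card_lt_card (Finset.filter_ssubset.2 ⟨j, Finset.mem_univ j, lt_irrefl _⟩)

lemma strictRank_lt_strictRank {v : ι → ℝ} {i j : ι} (h : v i < v j) :
    strictRank v i < strictRank v j := by
  refine Finset.card_lt_card (Finset.ssubset_iff_of_subset ?_ |>.2 ⟨i, by simpa using h, by simp⟩)
  intro k hk
  simp only [Finset.mem_filter, Finset.mem_univ, true_and] at hk ⊢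
  exact hk.trans h

lemma strictRank_injective {v : ι → ℝ} (hv : Function.Injective v) :
    Function.Injective (strictRank v) := by
  intro i j hij
  by_contra hne
  rcases lt_or_gt_of_ne (hv.ne hne) with h | h
  · exact (strictRank_lt_strictRank h).ne hij
  · exact (strictRank_lt_strictRank h).ne' hij

lemma image_strictRank {v : ι → ℝ} (hv : Function.Injective v) :
    Finset.univ.image (strictRank v) = Finset.range (Fintype.card ι) := by
  refine Finset.eq_of_subset_of_card_le ?_ ?_
  · simpa [Finset.image_subset_iff] using strictRank_lt_card v
  · rw [Finset.card_image_of_injective _ (strictRank_injective hv)]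
    simp

lemma card_filter_strictRank {v : ι → ℝ} (hv : Function.Injective v)
    (p : ℕ → Prop) [DecidablePred p] :
    (Finset.univ.filter (fun j => p (strictRank v j))).card
      = ((Finset.range (Fintype.card ι)).filter p).card := by
  rw [← image_strictRank hv, Finset.filter_image,
    Finset.card_image_of_injective _ (strictRank_injective hv)]

lemma strictRank_comp_perm (v : ι → ℝ) (σ : Equiv.Perm ι) (j : ι) :
    strictRank (fun i => v (σ i)) j = strictRank v (σ j) := by
  refine Finset.card_equiv σ ?_
  simp

lemma measurable_strictRank (j : ι) : Measurable (fun v : ι → ℝ => strictRank v j) := by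
  simp only [strictRank, Finset.card_filter]
  refine Finset.measurable_sum _ fun i _ => ?_
  exact Measurable.ite (measurableSet_lt (measurable_pi_apply i) (measurable_pi_apply j))
    measurable_const measurable_const

/-- The strict rank of a coordinate of an exchangeable, almost surely injective random vector is
uniformly distributed. -/
lemma card_mul_measure_strictRank {Ω : Type*} [MeasurableSpace Ω] {P : Measure Ω}
    [IsProbabilityMeasure P] {R : ι → Ω → ℝ} (hmeas : ∀ i, Measurable (R i))
    (hexch : ∀ σ : Equiv.Perm ι,
      Measure.map (fun ω i => R (σ i) ω) P = Measure.map (fun ω i => R i ω) P)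
    (hinj : ∀ᵐ ω ∂P, Function.Injective (fun i => R i ω))
    (p : ℕ → Prop) [DecidablePred p] (j : ι) :
    Fintype.card ι * P {ω | p (strictRank (fun i => R i ω) j)}
      = ((Finset.range (Fintype.card ι)).filter p).card := by
  classical
  have hset (k : ι) : MeasurableSet {v : ι → ℝ | p (strictRank v k)} :=
    measurable_strictRank k (MeasurableSet.of_discrete (s := {m | p m}))
  have hR : Measurable (fun ω i => R i ω) := measurable_pi_lambda _ hmeas
  have hsetΩ (k : ι) : MeasurableSet {ω | p (strictRank (fun i => R i ω) k)} := hR (hset k)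
  have hsame (k : ι) : P {ω | p (strictRank (fun i => R i ω) k)}
      = P {ω | p (strictRank (fun i => R i ω) j)} := by
    have h := congrArg (fun μ => μ {v : ι → ℝ | p (strictRank v j)}) (hexch (Equiv.swap j k))
    simp only [Measure.map_apply (measurable_pi_lambda _ fun i => hmeas (Equiv.swap j k i))
      (hset j), Measure.map_apply hR (hset j), Set.preimage_ofPred_eq] at h
    rw [← h]
    congr 1
    ext ω
    simp only [Set.mem_ofPred_eq]
    rw [strictRank_comp_perm (fun i => R i ω) (Equiv.swap j k) j, Equiv.swap_apply_left]
  calc Fintype.card ι * P {ω | p (strictRank (fun i => R i ω) j)}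
      = ∑ k, P {ω | p (strictRank (fun i => R i ω) k)} := by simp [hsame]
    _ = ∑ k, ∫⁻ ω, {ω | p (strictRank (fun i => R i ω) k)}.indicator 1 ω ∂P := by
        simp only [lintegral_indicator_one (hsetΩ _)]
    _ = ∫⁻ ω, ∑ k, {ω | p (strictRank (fun i => R i ω) k)}.indicator 1 ω ∂P :=
        (lintegral_finsetSum _ fun k _ => measurable_one.indicator (hsetΩ k)).symm
    _ = ∫⁻ _, (((Finset.range (Fintype.card ι)).filter p).card : ℝ≥0∞) ∂P := by
        refine lintegral_congr_ae ?_
        filter_upwards [hinj] with ω hω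
        rw [← card_filter_strictRank hω p, Finset.card_filter]
        simp [Set.indicator_apply]
    _ = ((Finset.range (Fintype.card ι)).filter p).card := by simp

end strictRank

lemma card_filter_succ_le_eq_strictRank {n : ℕ} {v : Fin (n + 1) → ℝ}
    (hv : Function.Injective v) :
    (Finset.univ.filter (fun i : Fin n => v i.succ ≤ v 0)).card = strictRank v 0 := by
  have h (i : Fin n) : v i.succ ≤ v 0 ↔ v i.succ < v 0 :=
    ⟨fun hi => hi.lt_of_ne (hv.ne (Fin.succ_ne_zero i)), le_of_lt⟩
  simp only [strictRank, h, Finset.card_filter, Fin.sum_univ_succ, lt_irrefl, if_false, zero_add]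

lemma card_filter_range_lt_lt {m : ℕ} {x : ℝ} (hx : 0 ≤ x) :
    (((Finset.range m).filter (fun k : ℕ => (k : ℝ) < x)).card : ℝ) < x + 1 := by
  have hsub : (Finset.range m).filter (fun k : ℕ => (k : ℝ) < x) ⊆ Finset.range ⌈x⌉₊ := by
    intro k hk
    simpa [Nat.lt_ceil] using (Finset.mem_filter.1 hk).2
  have hcard := Finset.card_le_card hsub
  rw [Finset.card_range] at hcard
  exact (Nat.cast_le.2 hcard).trans_lt (Nat.ceil_lt_add_one hx)

lemma lt_card_filter_range_le {m : ℕ} {x : ℝ} (hx : 0 ≤ x) (hxm : x < m) :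
    x < (((Finset.range m).filter (fun k : ℕ => (k : ℝ) ≤ x)).card : ℝ) := by
  have hsub : Finset.range (⌊x⌋₊ + 1) ⊆ (Finset.range m).filter (fun k : ℕ => (k : ℝ) ≤ x) := by
    intro k hk
    have hkx : (k : ℝ) ≤ x := (Nat.le_floor_iff hx).1 (Nat.lt_succ_iff.1 (Finset.mem_range.1 hk))
    exact Finset.mem_filter.2 ⟨Finset.mem_range.2 (Nat.cast_lt.1 (hkx.trans_lt hxm)), hkx⟩
  have hcard := Finset.card_le_card hsub
  rw [Finset.card_range] at hcard
  refine (Nat.lt_floor_add_one x).trans_le ?_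
  exact_mod_cast hcard

/-- One-sided bounds on the rank of `R 0` among exchangeable, almost surely pairwise
distinct random variables `R 0, R 1, …, R n`:
`P(#{i : R i ≤ R 0} < (n+1)α/2) < α/2 + 1/(n+1)` and
`P(#{i : R i ≤ R 0} ≤ (n+1)(1-α/2)) > 1 - α/2`. -/
theorem rank_onesided_bounds {Ω : Type*} [MeasurableSpace Ω] (P : Measure Ω)
    [IsProbabilityMeasure P]
    (n : ℕ) (R : Fin (n + 1) → Ω → ℝ) (hmeas : ∀ i, Measurable (R i))
    (hexch : ∀ σ : Equiv.Perm (Fin (n + 1)),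
      Measure.map (fun ω i => R (σ i) ω) P = Measure.map (fun ω i => R i ω) P)
    (hdist : ∀ i j, i ≠ j → P {ω | R i ω = R j ω} = 0)
    (α : ℝ) (hα : α ∈ Set.Ioo (0 : ℝ) 1) :
    (P {ω | ((Finset.univ.filter (fun i : Fin n => R i.succ ω ≤ R 0 ω)).card : ℝ)
          < (n + 1) * α / 2}).toReal < α / 2 + 1 / (n + 1) ∧
    (P {ω | ((Finset.univ.filter (fun i : Fin n => R i.succ ω ≤ R 0 ω)).card : ℝ)
          ≤ (n + 1) * (1 - α / 2)}).toReal > 1 - α / 2 := by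
  classical
  have hinj : ∀ᵐ ω ∂P, Function.Injective (fun i => R i ω) := by
    have h : ∀ᵐ ω ∂P, ∀ i j, i ≠ j → R i ω ≠ R j ω := by
      simp only [ae_all_iff]
      intro i j hij
      simpa [ae_iff] using hdist i j hij
    filter_upwards [h] with ω hω i j hij
    exact not_imp_not.1 (hω i j) hij
  have key (p : ℕ → Prop) [DecidablePred p] :
      (n + 1) * (P {ω | p (Finset.univ.filter (fun i : Fin n => R i.succ ω ≤ R 0 ω)).card}).toReal
        = ((Finset.range (n + 1)).filter p).card := by
    have hae : P {ω | p (Finset.univ.filter (fun i : Fin n => R i.succ ω ≤ R 0 ω)).card}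
        = P {ω | p (strictRank (fun i => R i ω) 0)} := by
      refine measure_congr ?_
      filter_upwards [hinj] with ω hω
      exact congrArg p (card_filter_succ_le_eq_strictRank hω)
    have h := congrArg ENNReal.toReal (card_mul_measure_strictRank hmeas hexch hinj p 0)
    rw [ENNReal.toReal_mul, ENNReal.toReal_natCast, ENNReal.toReal_natCast, Fintype.card_fin,
      Nat.cast_succ] at h
    rw [hae, h]
  obtain ⟨hα0, hα1⟩ := hα
  have hn : (0 : ℝ) < n + 1 := by positivity
  constructor
  · have h := key (fun k => (k : ℝ) < (n + 1) * α / 2)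
    have hlt := card_filter_range_lt_lt (m := n + 1) (x := (n + 1) * α / 2) (by positivity)
    rw [← h] at hlt
    refine lt_of_mul_lt_mul_left (hlt.trans_eq ?_) hn.le
    field_simp
  · have h := key (fun k => (k : ℝ) ≤ (n + 1) * (1 - α / 2))
    have hlt := lt_card_filter_range_le (m := n + 1) (x := (n + 1) * (1 - α / 2))
      (mul_nonneg hn.le (by linarith)) (by push_cast; nlinarith)
    rw [← h] at hlt
    exact lt_of_mul_lt_mul_left hlt hn.le
end

section
/- Let R_0, R_1, ..., R_n be real-valued random variables on a probability space that are exchangeable and almost surely pairwise distinct, and define the conformal p-value p_val = (1 + #{i ∈ {1,...,n} : R_i ≤ R_0})/(n+1). Then for every t ∈ [0,1], P(p_val ≤ t) ≤ t. -/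
open MeasureTheory ProbabilityTheory Finset
open scoped ENNReal

/-- At most `k` members of a finite family have weak rank at most `k`. -/
theorem card_filter_card_le_le {ι α : Type*} [Fintype ι] [LinearOrder α] (v : ι → α) (k : ℕ) :
    #{j | #{i | v i ≤ v j} ≤ k} ≤ k := by
  rcases Finset.eq_empty_or_nonempty ({j | #{i | v i ≤ v j} ≤ k} : Finset ι) with h | h
  · simp [h]
  · obtain ⟨j, hj, hmax⟩ := Finset.exists_max_image _ v h
    refine (Finset.card_le_card fun i hi => ?_).trans (Finset.mem_filter.1 hj).2
    simpa using hmax i hi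

theorem measurableSet_card_filter_le {ι : Type*} [Fintype ι] (j : ι) (k : ℕ) :
    MeasurableSet {v : ι → ℝ | #{i | v i ≤ v j} ≤ k} := by
  simp_rw [Finset.card_filter]
  refine measurableSet_le (Finset.measurable_sum _ fun i _ => ?_) measurable_const
  exact Measurable.ite (measurableSet_le (measurable_pi_apply i) (measurable_pi_apply j))
    measurable_const measurable_const

/-- Under a permutation-invariant law on `ι → ℝ`, a coordinate has weak rank at most `k` with
probability at most `k / card ι`. -/
theorem card_mul_measure_card_filter_le_le {ι : Type*} [Fintype ι]
    (μ : Measure (ι → ℝ)) [IsProbabilityMeasure μ]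
    (hμ : ∀ σ : Equiv.Perm ι, μ.map (fun v i => v (σ i)) = μ) (j : ι) (k : ℕ) :
    Fintype.card ι * μ {v | #{i | v i ≤ v j} ≤ k} ≤ k := by
  classical
  have hsymm (l : ι) : μ {v | #{i | v i ≤ v l} ≤ k} = μ {v | #{i | v i ≤ v j} ≤ k} := by
    conv_rhs => rw [← hμ (Equiv.swap j l)]
    rw [Measure.map_apply (by fun_prop) (measurableSet_card_filter_le j k)]
    congr 1
    ext v
    have hcard : #{i | v (Equiv.swap j l i) ≤ v l} = #{i | v i ≤ v l} :=
      Finset.card_equiv (Equiv.swap j l) (by simp)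
    simp [hcard]
  calc Fintype.card ι * μ {v | #{i | v i ≤ v j} ≤ k}
      = ∑ l, μ {v | #{i | v i ≤ v l} ≤ k} := by simp [hsymm]
    _ = ∫⁻ v, ∑ l, {v : ι → ℝ | #{i | v i ≤ v l} ≤ k}.indicator 1 v ∂μ := by
      rw [lintegral_finsetSum _ fun l _ =>
        measurable_one.indicator (measurableSet_card_filter_le l k)]
      exact Finset.sum_congr rfl fun l _ =>
        (lintegral_indicator_one (measurableSet_card_filter_le l k)).symm
    _ ≤ ∫⁻ _, k ∂μ := by
      refine lintegral_mono fun v => ?_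
      simp only [Set.indicator_apply, Set.mem_ofPred_eq, Pi.one_apply, Finset.sum_boole]
      exact_mod_cast card_filter_card_le_le v k
    _ = k := by simp

/-- Super-uniformity of the conformal p-value: if `R 0, R 1, …, R n` are exchangeable and
almost surely pairwise distinct, and `p_val = (1 + #{i : R i ≤ R 0})/(n+1)`, then for every
`t ∈ [0,1]`, `P(p_val ≤ t) ≤ t`. -/
theorem conformal_pvalue_superuniform {Ω : Type*} [MeasurableSpace Ω] (P : Measure Ω)
    [IsProbabilityMeasure P]
    (n : ℕ) (R : Fin (n + 1) → Ω → ℝ) (hmeas : ∀ i, Measurable (R i))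
    (hexch : ∀ σ : Equiv.Perm (Fin (n + 1)),
      Measure.map (fun ω i => R (σ i) ω) P = Measure.map (fun ω i => R i ω) P)
    (hdist : ∀ i j, i ≠ j → P {ω | R i ω = R j ω} = 0)
    (t : ℝ) (ht : t ∈ Set.Icc (0 : ℝ) 1) :
    (P {ω | (1 + ((Finset.univ.filter (fun i : Fin n => R i.succ ω ≤ R 0 ω)).card : ℝ))
              / (n + 1) ≤ t}).toReal ≤ t := by
  have hR : Measurable fun ω i => R i ω := measurable_pi_lambda _ hmeas
  have : IsProbabilityMeasure (P.map fun ω i => R i ω) :=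
    Measure.isProbabilityMeasure_map hR.aemeasurable
  have hn : (0 : ℝ) < n + 1 := by positivity
  have hs : 0 ≤ t * (n + 1) := mul_nonneg ht.1 hn.le
  have key := card_mul_measure_card_filter_le_le (P.map fun ω i => R i ω)
    (fun σ => by rw [Measure.map_map (by fun_prop) hR]; exact hexch σ) 0 ⌊t * (n + 1)⌋₊
  rw [Measure.map_apply hR (measurableSet_card_filter_le _ _)] at key
  have hset : {ω | (1 + ((Finset.univ.filter (fun i : Fin n => R i.succ ω ≤ R 0 ω)).card : ℝ))
      / (n + 1) ≤ t} = (fun ω i => R i ω) ⁻¹' {v | #{i | v i ≤ v 0} ≤ ⌊t * (n + 1)⌋₊} := by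
    ext ω
    simp only [Set.mem_ofPred_eq, Set.mem_preimage, Nat.le_floor_iff hs, div_le_iff₀ hn,
      Fin.card_filter_univ_succ, le_refl, if_true]
    push_cast
    rw [add_comm]
  rw [hset]
  have key' := ENNReal.toReal_mono (ENNReal.natCast_ne_top _) key
  simp only [ENNReal.toReal_mul, ENNReal.toReal_natCast, Fintype.card_fin] at key'
  push_cast at key'
  refine le_of_mul_le_mul_left ?_ hn
  linarith [Nat.floor_le hs]
end

section
/- Let n ≥ 1, let r_1, ..., r_n and r̃_1, ..., r̃_n be real numbers, let x ∈ ℝ and δ ≥ 0. Then | (1/n)·Σ_{i=1}^n 1(r_i ≤ x) − (1/n)·Σ_{i=1}^n 1(r̃_i ≤ x + δ) | ≤ (1/n)·Σ_{i=1}^n 1(|r_i − r̃_i| > δ) + (1/n)·Σ_{i=1}^n 1(x < r_i ≤ x + 2δ). -/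
open Finset

/-- Pointwise comparison of the threshold indicators of two real numbers. -/
theorem abs_indicator_sub_le (a b x δ : ℝ) :
    |(if a ≤ x then (1 : ℝ) else 0) - (if b ≤ x + δ then (1 : ℝ) else 0)|
      ≤ (if |a - b| > δ then (1 : ℝ) else 0)
        + (if x < a ∧ a ≤ x + 2 * δ then (1 : ℝ) else 0) := by
  have h₁ := le_abs_self (a - b)
  have h₂ := neg_abs_le (a - b)
  split_ifs <;> norm_num <;> grind

/-- Empirical-CDF comparison inequality from the proof of Theorem 2.1:
`|G_n(x) - G̃_n(x + δ)| ≤ (1/n)·Σ 1(|r_i - r̃_i| > δ) + (1/n)·Σ 1(x < r_i ≤ x + 2δ)`. -/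
theorem empirical_cdf_comparison (n : ℕ) (hn : 1 ≤ n) (r rt : Fin n → ℝ)
    (x δ : ℝ) (hδ : 0 ≤ δ) :
    |(1 / n : ℝ) * ∑ i : Fin n, (if r i ≤ x then (1 : ℝ) else 0)
      - (1 / n : ℝ) * ∑ i : Fin n, (if rt i ≤ x + δ then (1 : ℝ) else 0)|
      ≤ (1 / n : ℝ) * ∑ i : Fin n, (if |r i - rt i| > δ then (1 : ℝ) else 0)
        + (1 / n : ℝ) * ∑ i : Fin n, (if x < r i ∧ r i ≤ x + 2 * δ then (1 : ℝ) else 0) := by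
  rw [← mul_sub, ← mul_add, abs_mul, abs_of_nonneg (by positivity : (0 : ℝ) ≤ 1 / n),
    ← Finset.sum_sub_distrib, ← Finset.sum_add_distrib]
  refine mul_le_mul_of_nonneg_left ?_ (by positivity)
  exact (Finset.abs_sum_le_sum_abs _ _).trans
    (Finset.sum_le_sum fun i _ => abs_indicator_sub_le (r i) (rt i) x δ)
end

section
/- Let n ≥ 1, let r_1 < r_2 < ... < r_n be distinct real numbers, let L ∈ ℝ, and let α ∈ (0,1) be such that neither α(n+1)/2 nor (1−α/2)(n+1) is an integer, with 1 ≤ k_1 := ⌊α(n+1)/2⌋ and k_2 := ⌊(1−α/2)(n+1)⌋ ≤ n. For π ∈ (0,1) define the conformal p-value p(π) = (1 + #{i ∈ {1,...,n} : logit(π) − L ≥ r_i})/(n+1). Then {π ∈ (0,1) : α/2 ≤ p(π) and p(π) ≤ 1 − α/2} = {π ∈ (0,1) : expit(L + r_{k_1}) ≤ π < expit(L + r_{k_2})}. -/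
open Finset

/-- `logit p = log (p / (1 - p))`. -/
noncomputable def logit (p : ℝ) : ℝ := Real.log (p / (1 - p))

/-- `expit x = 1 / (1 + exp (-x))`, the inverse of `logit`. -/
noncomputable def expit (x : ℝ) : ℝ := 1 / (1 + Real.exp (-x))

theorem expit_le_iff_le_logit {x p : ℝ} (hp : p ∈ Set.Ioo (0 : ℝ) 1) :
    expit x ≤ p ↔ x ≤ logit p := by
  obtain ⟨hp0, hp1⟩ := hp
  have hq : 0 < 1 - p := sub_pos.mpr hp1
  have hx : Real.exp x * Real.exp (-x) = 1 := by rw [← Real.exp_add]; simp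
  have hpos := Real.exp_pos x
  have hneg := Real.exp_pos (-x)
  rw [expit, logit, Real.le_log_iff_exp_le (div_pos hp0 hq), le_div_iff₀ hq,
    div_le_iff₀ (by positivity)]
  constructor <;> intro h <;> nlinarith

/-- For increasing scores, at least `k` of them are at most `t` iff the `k`-th one is. -/
theorem le_card_filter_le_iff {n k : ℕ} {r : ℕ → ℝ}
    (hr : ∀ i j, 1 ≤ i → i < j → j ≤ n → r i < r j) (hk : 1 ≤ k) (hkn : k ≤ n) (t : ℝ) :
    k ≤ ((Finset.Icc 1 n).filter (fun i => r i ≤ t)).card ↔ r k ≤ t := by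
  constructor
  · intro h
    by_contra! ht
    have hsub : (Finset.Icc 1 n).filter (fun i => r i ≤ t) ⊆ Finset.Icc 1 (k - 1) := by
      intro i hi
      simp only [Finset.mem_filter, Finset.mem_Icc] at hi ⊢
      refine ⟨hi.1.1, ?_⟩
      by_contra! hik
      rcases (show k ≤ i by omega).eq_or_lt with rfl | hlt
      · exact ht.not_ge hi.2
      · linarith [hr k i hk hlt hi.1.2, hi.2]
    have hcard := Finset.card_le_card hsub
    rw [Nat.card_Icc] at hcard
    omega
  · intro ht
    have hsub : Finset.Icc 1 k ⊆ (Finset.Icc 1 n).filter (fun i => r i ≤ t) := by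
      intro i hi
      simp only [Finset.mem_filter, Finset.mem_Icc] at hi ⊢
      refine ⟨⟨hi.1, hi.2.trans hkn⟩, ?_⟩
      rcases hi.2.eq_or_lt with rfl | hlt
      · exact ht
      · exact (hr i k hi.1 hlt hkn).le.trans ht
    simpa using Finset.card_le_card hsub

/-- The conformal p-value acceptance region is exactly an explicit interval: with
conformity scores `r 1 < r 2 < … < r n`, `L = logit (p_n (x_new))`, and
`p(π) = (1 + #{i : logit π - L ≥ r i})/(n+1)`, assuming that neither `α(n+1)/2` nor
`(1-α/2)(n+1)` is an integer and that `1 ≤ k₁ = ⌊α(n+1)/2⌋`, `k₂ = ⌊(1-α/2)(n+1)⌋ ≤ n`,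
we have `{π ∈ (0,1) : α/2 ≤ p(π) ≤ 1 - α/2} = {π ∈ (0,1) : expit (L + r k₁) ≤ π < expit (L + r k₂)}`. -/
theorem conformal_pvalue_set_is_interval (n : ℕ) (hn : 1 ≤ n)
    (r : ℕ → ℝ) (hr : ∀ i j, 1 ≤ i → i < j → j ≤ n → r i < r j)
    (L : ℝ) (α : ℝ) (hα : α ∈ Set.Ioo (0 : ℝ) 1)
    (hnotint₁ : ∀ m : ℕ, α * (n + 1) / 2 ≠ m)
    (hnotint₂ : ∀ m : ℕ, (1 - α / 2) * (n + 1) ≠ m)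
    (k₁ k₂ : ℕ) (hk₁ : k₁ = ⌊α * (n + 1) / 2⌋₊) (hk₂ : k₂ = ⌊(1 - α / 2) * (n + 1)⌋₊)
    (hk₁' : 1 ≤ k₁) (hk₂' : k₂ ≤ n) :
    {π : ℝ | π ∈ Set.Ioo (0 : ℝ) 1 ∧
      α / 2 ≤ (1 + (((Finset.Icc 1 n).filter (fun i => r i ≤ logit π - L)).card : ℝ)) / (n + 1) ∧
      (1 + (((Finset.Icc 1 n).filter (fun i => r i ≤ logit π - L)).card : ℝ)) / (n + 1)
        ≤ 1 - α / 2}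
    = {π : ℝ | π ∈ Set.Ioo (0 : ℝ) 1 ∧ expit (L + r k₁) ≤ π ∧ π < expit (L + r k₂)} := by
  obtain ⟨hα0, hα1⟩ := hα
  have hn1 : (0 : ℝ) < n + 1 := by positivity
  have hk₁₂ : k₁ ≤ k₂ := by
    rw [hk₁, hk₂]
    exact Nat.floor_le_floor (by nlinarith)
  ext p
  simp only [Set.mem_ofPred_eq]
  refine and_congr_right fun hp => and_congr ?_ ?_
  · rw [expit_le_iff_le_logit hp, ← le_sub_iff_add_le',
      ← le_card_filter_le_iff hr hk₁' (hk₁₂.trans hk₂'), le_div_iff₀ hn1]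
    set c := ((Finset.Icc 1 n).filter (fun i => r i ≤ logit p - L)).card
    have hne := hnotint₁ (c + 1)
    push_cast at hne
    rw [← Nat.lt_succ_iff, hk₁, Nat.floor_lt (by positivity), Nat.cast_succ, ← hne.le_iff_lt,
      add_comm (1 : ℝ), div_mul_eq_mul_div]
  · rw [← not_le, expit_le_iff_le_logit hp, ← le_sub_iff_add_le',
      ← le_card_filter_le_iff hr (hk₁'.trans hk₁₂) hk₂', not_le, div_le_iff₀ hn1]
    set c := ((Finset.Icc 1 n).filter (fun i => r i ≤ logit p - L)).card
    rw [← Nat.succ_le_iff, hk₂, Nat.le_floor_iff (by nlinarith), Nat.cast_succ,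
      add_comm (1 : ℝ)]
end

section
/- Let R_0, R_1, ..., R_n be real-valued random variables on a probability space that are exchangeable and almost surely pairwise distinct, and let t ∈ (0,1). Then P( (1/n)·#{i ∈ {1,...,n} : R_i ≤ R_0} ≤ ((n+1)/n)·t ) = k/(n+1) for the unique integer k with k ≤ (n+1)t + 1 < k + 1, and in particular this probability lies within 1/(n+1) of t. -/
open MeasureTheory ProbabilityTheory Finset
open scoped ENNReal

/-- The rank of the `j`-th entry of `x`: the number of entries that do not exceed it. -/
def entryRank {ι α : Type*} [Fintype ι] [LinearOrder α] (x : ι → α) (j : ι) : ℕ :=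
  #{i | x i ≤ x j}

section EntryRank

variable {ι α : Type*} [Fintype ι] [LinearOrder α]

lemma entryRank_comp_perm (x : ι → α) (σ : Equiv.Perm ι) (j : ι) :
    entryRank (fun i => x (σ i)) j = entryRank x (σ j) := by
  unfold entryRank
  exact Finset.card_equiv σ (by simp)

lemma entryRank_lt_entryRank {x : ι → α} {i j : ι} (h : x i < x j) :
    entryRank x i < entryRank x j := by
  refine Finset.card_lt_card (Finset.ssubset_iff_of_subset ?_ |>.2 ⟨j, by simp, by simpa using h⟩)
  intro l hl
  simp only [Finset.mem_filter, Finset.mem_univ, true_and] at hl ⊢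
  exact hl.trans h.le

lemma entryRank_injective {x : ι → α} (hx : Function.Injective x) :
    Function.Injective (entryRank x) := by
  intro i j hij
  by_contra hne
  rcases lt_or_gt_of_ne (hx.ne hne) with h | h
  · exact (entryRank_lt_entryRank h).ne hij
  · exact (entryRank_lt_entryRank h).ne' hij

lemma image_entryRank {x : ι → α} (hx : Function.Injective x) :
    Finset.univ.image (entryRank x) = Finset.Icc 1 (Fintype.card ι) := by
  refine Finset.eq_of_subset_of_card_le ?_ ?_
  · intro r hr
    obtain ⟨j, -, rfl⟩ := Finset.mem_image.1 hr
    exact Finset.mem_Icc.2 ⟨Finset.card_pos.2 ⟨j, by simp⟩, Finset.card_le_univ _⟩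
  · rw [Finset.card_image_of_injective _ (entryRank_injective hx)]
    simp

lemma card_entryRank_le {x : ι → α} (hx : Function.Injective x) {k : ℕ}
    (hk : k ≤ Fintype.card ι) : #{j | entryRank x j ≤ k} = k := by
  rw [← Finset.card_image_of_injective _ (entryRank_injective hx), ← Finset.filter_image (p := (· ≤ k)),
    image_entryRank hx]
  have h : (Finset.Icc 1 (Fintype.card ι)).filter (· ≤ k) = Finset.Icc 1 k := by
    ext r
    simp only [Finset.mem_filter, Finset.mem_Icc]
    omega
  rw [h, Nat.card_Icc, Nat.add_sub_cancel]

end EntryRank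

lemma measurable_entryRank {ι : Type*} [Fintype ι] (j : ι) :
    Measurable fun x : ι → ℝ => entryRank x j := by
  simp only [entryRank, Finset.card_filter]
  exact Finset.measurable_sum _ fun i _ =>
    Measurable.ite (measurableSet_le (measurable_pi_apply i) (measurable_pi_apply j))
      measurable_const measurable_const

lemma entryRank_zero {α : Type*} [LinearOrder α] {n : ℕ} (x : Fin (n + 1) → α) :
    entryRank x 0 = #{i : Fin n | x i.succ ≤ x 0} + 1 := by
  rw [entryRank, Finset.card_filter, Fin.sum_univ_succ, Finset.card_filter, if_pos le_rfl,
    add_comm]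

/-- The ranks of exchangeable, almost surely pairwise distinct random variables are uniformly
distributed. -/
lemma card_mul_measure_entryRank_le {Ω ι : Type*} [MeasurableSpace Ω] [Fintype ι]
    {P : Measure Ω} [IsProbabilityMeasure P] {R : ι → Ω → ℝ} (hmeas : ∀ i, Measurable (R i))
    (hexch : ∀ σ : Equiv.Perm ι,
      Measure.map (fun ω i => R (σ i) ω) P = Measure.map (fun ω i => R i ω) P)
    (hdist : ∀ i j, i ≠ j → P {ω | R i ω = R j ω} = 0)
    {k : ℕ} (hk : k ≤ Fintype.card ι) (j : ι) :
    Fintype.card ι * P {ω | entryRank (fun i => R i ω) j ≤ k} = k := by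
  classical
  have hinj : ∀ᵐ ω ∂P, Function.Injective fun i => R i ω := by
    have h : ∀ᵐ ω ∂P, ∀ i j, i ≠ j → R i ω ≠ R j ω := by
      simp only [ae_all_iff]
      intro i j hij
      simpa [ae_iff] using hdist i j hij
    filter_upwards [h] with ω hω i j hij
    by_contra hne
    exact hω i j hne hij
  have hset (l : ι) : MeasurableSet {x : ι → ℝ | entryRank x l ≤ k} :=
    measurableSet_le (measurable_entryRank l) measurable_const
  have hR : Measurable fun ω i => R i ω := measurable_pi_lambda _ hmeas
  have heq (l : ι) : P {ω | entryRank (fun i => R i ω) l ≤ k} =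
      P {ω | entryRank (fun i => R i ω) j ≤ k} := by
    have h := congrArg (fun μ => μ {x : ι → ℝ | entryRank x j ≤ k}) (hexch (Equiv.swap j l))
    rw [Measure.map_apply (measurable_pi_lambda _ fun i => hmeas _) (hset j),
      Measure.map_apply hR (hset j)] at h
    have hperm (ω : Ω) : entryRank (fun i => R (Equiv.swap j l i) ω) j =
        entryRank (fun i => R i ω) l := by
      rw [entryRank_comp_perm (fun i => R i ω), Equiv.swap_apply_left]
    simpa only [Set.preimage_ofPred_eq, hperm] using h
  calc Fintype.card ι * P {ω | entryRank (fun i => R i ω) j ≤ k}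
      = ∑ l, P {ω | entryRank (fun i => R i ω) l ≤ k} := by
        simp [heq]
    _ = ∑ l, ∫⁻ ω, {ω | entryRank (fun i => R i ω) l ≤ k}.indicator 1 ω ∂P :=
        Finset.sum_congr rfl fun l _ => (lintegral_indicator_one (hR (hset l))).symm
    _ = ∫⁻ ω, ∑ l, {ω | entryRank (fun i => R i ω) l ≤ k}.indicator 1 ω ∂P :=
        (lintegral_finsetSum _ fun l _ => measurable_one.indicator (hR (hset l))).symm
    _ = ∫⁻ _, (k : ℝ≥0∞) ∂P := by
        refine lintegral_congr_ae ?_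
        filter_upwards [hinj] with ω hω
        simp only [Set.indicator_apply, Set.mem_ofPred_eq, Pi.one_apply, Finset.sum_boole]
        rw [card_entryRank_le hω hk]
    _ = k := by simp

/-- Exact distributional identity for the augmented empirical CDF evaluated at `R 0`
(from the proof of Proposition 2.1): for exchangeable, almost surely pairwise distinct
`R 0, R 1, …, R n` and `t ∈ (0,1)`,
`P(G_n(R 0) ≤ ((n+1)/n)·t) = k/(n+1)` where `k` is the unique integer with
`k ≤ (n+1)t + 1 < k + 1`; in particular this probability is within `1/(n+1)` of `t`. -/
theorem empirical_cdf_at_new_point {Ω : Type*} [MeasurableSpace Ω] (P : Measure Ω)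
    [IsProbabilityMeasure P]
    (n : ℕ) (hn : 1 ≤ n) (R : Fin (n + 1) → Ω → ℝ) (hmeas : ∀ i, Measurable (R i))
    (hexch : ∀ σ : Equiv.Perm (Fin (n + 1)),
      Measure.map (fun ω i => R (σ i) ω) P = Measure.map (fun ω i => R i ω) P)
    (hdist : ∀ i j, i ≠ j → P {ω | R i ω = R j ω} = 0)
    (t : ℝ) (ht : t ∈ Set.Ioo (0 : ℝ) 1)
    (k : ℕ) (hk : (k : ℝ) ≤ (n + 1) * t + 1 ∧ (n + 1) * t + 1 < k + 1) :
    (P {ω | (((Finset.univ.filter (fun i : Fin n => R i.succ ω ≤ R 0 ω)).card : ℝ)) / n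
          ≤ ((n + 1) / n) * t}).toReal = k / (n + 1) ∧
    |(k : ℝ) / (n + 1) - t| ≤ 1 / (n + 1) := by
  have hn' : (0 : ℝ) < n := by exact_mod_cast hn
  have hpos : (0 : ℝ) < n + 1 := by positivity
  obtain ⟨hk₁, hk₂⟩ := hk
  have hkn : k ≤ n + 1 := by
    have h : (k : ℝ) < (n + 1 : ℕ) + 1 := by
      push_cast
      nlinarith [ht.2]
    exact Nat.lt_succ_iff.1 (by exact_mod_cast h)
  have hevent (ω : Ω) : ((#{i : Fin n | R i.succ ω ≤ R 0 ω} : ℝ) / n ≤ ((n + 1) / n) * t) ↔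
      entryRank (fun i => R i ω) 0 ≤ k := by
    rw [entryRank_zero, div_mul_eq_mul_div, div_le_div_iff_of_pos_right hn']
    constructor
    · intro h
      exact Nat.lt_succ_iff.1 (by
        have : (#{i : Fin n | R i.succ ω ≤ R 0 ω} : ℝ) + 1 < k + 1 := by linarith
        exact_mod_cast this)
    · intro h
      have : (#{i : Fin n | R i.succ ω ≤ R 0 ω} : ℝ) + 1 ≤ k := by exact_mod_cast h
      linarith
  constructor
  · simp only [hevent]
    have h := congrArg ENNReal.toReal
      (card_mul_measure_entryRank_le hmeas hexch hdist (k := k) (by simpa using hkn) 0)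
    rw [ENNReal.toReal_mul, ENNReal.toReal_natCast, ENNReal.toReal_natCast, Fintype.card_fin,
      Nat.cast_add_one] at h
    rw [eq_div_iff hpos.ne', mul_comm, h]
  · rw [div_sub' hpos.ne', abs_div, abs_of_pos hpos]
    gcongr
    rw [abs_le]
    constructor <;> linarith
end
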